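/- Let $S^1=[0,2\pi)$ be the circle with its arc-length metric $d_{S^1}$, let $\mathcal M_1(X)$ denote the set of Borel probability measures on $X$, and equip $\mathcal M_1(S^1\times[0,1])$ with the weak topology. For $\sigma,\tau\in\mathcal M_1(S^1\times[0,1])$ let $d_{KR}(\sigma,\tau)=\sup_f|\int f\,d\sigma-\int f\,d\tau|$, the supremum being over all $f$ with $\sup|f|\le1$ that are $1$-Lipschitz for the metric $d_{S^1}(\theta,\theta')+|t-t'|$. Let $H(\nu|\nu')=\int f\log f\,d\nu'\in[0,\infty]$ if $\nu\ll\nu'$ with $f=d\nu/d\nu'$, and $H(\nu|\nu')=+\infty$ otherwise. Let $\lambda$ be a Borel probability measure on $S^1$. For $m\ge1$ partition $[0,1]$ into $I_i=[\frac{i-1}m,\frac im)$ for $1\le i<m$ and $I_m=[\frac{m-1}m,1]$, and for $\sigma\in\mathcal M_1(S^1\times[0,1])$ put $\mathcal I_m(\sigma)=\frac1m\sum_{i=1}^mH(\nu_i|\lambda)$ if $\sigma(d\theta,dt)=\sum_{i=1}^m\nu_i(d\theta)\mathbf 1_{I_i}(t)\,dt$ for some $\nu_1,\dots,\nu_m\in\mathcal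 M_1(S^1)$, and $\mathcal I_m(\sigma)=+\infty$ otherwise. For $\mu\in\mathcal M_1(S^1\times[0,1])$ define $$\mathcal I(\mu)=\sup_{\delta>0}\ \liminf_{m\to\infty}\ \inf\{\mathcal I_m(\sigma):\sigma\in\mathcal M_1(S^1\times[0,1]),\ d_{KR}(\mu,\sigma)<\delta\}.$$ Finally, let $\mathcal N_1$ be the set of normalized driving measures, that is, of those $\mu\in\mathcal M_1(S^1\times[0,1])$ with $\mu(S^1\times J)=|J|$ for every interval $J\subset[0,1]$, where $|J|$ is the length of $J$. Then $\mathcal I(\mu)=H(\mu\,|\,\lambda(d\theta)\,dt)$ for every $\mu\in\mathcal N_1$, where $\lambda(d\theta)\,dt$ is the product of $\lambda$ with Lebesgue measure on $[0,1]$, and $\mathcal I(\mu)=+\infty$ for every $\mu\in\mathcal M_1(S^1\times[0,1])\setminus\mathcal N_1$. Moreover, $\mathcal I$ is a good rate function on $\mathcal M_1(S^1\times[0,1])$: it is lower semicontinuous with values in $[0,\infty]$, and its sublevel sets $\{\mathcal I\le a\}$, $0\le a<\infty$, are compact. -/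

import Mathlib

open MeasureTheory Filter
open scoped ENNReal NNReal

noncomputable section

namespace HLEntropy

/-- The circle `S¹ = [0, 2π)`; its distance is the arc-length distance. -/
abbrev Circ : Type := AddCircle (2 * Real.pi)

/-- The cylinder `S¹ × [0,1]`. -/
abbrev Cyl : Type := Circ × unitInterval

/-- The Kantorovich–Rubinstein distance. The test functions are bounded by `1` and `1`-Lipschitz
for the sum metric `d((θ,t),(θ',t')) = d_{S¹}(θ,θ') + |t - t'|`, which is written out because the
distance that Lean puts on a product is the maximum. -/
def dKR (σ τ : ProbabilityMeasure Cyl) : ℝ :=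
  sSup {r : ℝ | ∃ f : Cyl → ℝ,
    (∀ x y, |f x - f y| ≤ dist x.1 y.1 + dist x.2 y.2) ∧ (∀ x, |f x| ≤ 1) ∧
    r = |(∫ x, f x ∂(σ : Measure Cyl)) - ∫ x, f x ∂(τ : Measure Cyl)|}

/-- The `m` blocks of `[0,1]`: with `i` counted from `0`, this is `[i/m, (i+1)/m)`, and the last
block `i + 1 = m` also contains the endpoint `1`. -/
def timeBlock (m : ℕ) (i : Fin m) : Set unitInterval :=
  {t | ((i : ℕ) : ℝ) / m ≤ t ∧ ((t : ℝ) < (((i : ℕ) : ℝ) + 1) / m ∨ (i : ℕ) + 1 = m)}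

/-- The measure `∑ i, ν_i(dθ) 1_{I_i}(t) dt` on the cylinder. -/
def stepMeasure (m : ℕ) (ν : Fin m → ProbabilityMeasure Circ) : Measure Cyl :=
  ∑ i, (ν i : Measure Circ).prod ((volume : Measure unitInterval).restrict (timeBlock m i))

/-- `I_m(σ) = (1/m) ∑ i, H(ν_i | λ)` if `σ = ∑ i, ν_i(dθ) 1_{I_i}(t) dt`, and `+∞` if `σ` is not of
this form. The `ν_i` are determined by `σ`, so the infimum is over at most one family, and the
infimum over the empty family is `+∞`. For probability measures, `klDiv ν λ` is the relative
entropy `∫ f log f dλ` with `f = dν/dλ`, and `+∞` if `ν` is not absolutely continuous. -/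
def stepRate (lam : ProbabilityMeasure Circ) (m : ℕ) (σ : ProbabilityMeasure Cyl) : ℝ≥0∞ :=
  ⨅ (ν : Fin m → ProbabilityMeasure Circ) (_ : (σ : Measure Cyl) = stepMeasure m ν),
    (m : ℝ≥0∞)⁻¹ * ∑ i, InformationTheory.klDiv (ν i : Measure Circ) (lam : Measure Circ)

/-- `I(μ) = sup_{δ>0} liminf_{m→∞} inf {I_m(σ) : d_KR(μ,σ) < δ}`. -/
def approxRate (lam : ProbabilityMeasure Circ) (μ : ProbabilityMeasure Cyl) : ℝ≥0∞ :=
  ⨆ (δ : ℝ) (_ : 0 < δ), liminf (fun m : ℕ =>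
    ⨅ (σ : ProbabilityMeasure Cyl) (_ : dKR μ σ < δ), stepRate lam m σ) atTop

/-- Normalized driving measures: `μ(S¹ × J) = |J|` for every interval `J ⊆ [0,1]`. -/
def IsDriving (μ : ProbabilityMeasure Cyl) : Prop :=
  ∀ J : Set unitInterval, J.OrdConnected →
    (μ : Measure Cyl) (Set.univ ×ˢ J) = (volume : Measure unitInterval) J

/-- A good rate function: lower semicontinuous with values in `[0,∞]`, and with compact sublevel
sets. -/
def IsGoodRateFunction {X : Type*} [TopologicalSpace X] (I : X → ℝ≥0∞) : Prop :=
  LowerSemicontinuous I ∧ ∀ a : ℝ≥0, IsCompact {x | I x ≤ a}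

end HLEntropy

end

namespace HLEntropy

section Duality

open InformationTheory Topology

variable {X : Type*} [MeasurableSpace X]

/-- The functional `∫ g dμ - ∫ (exp g - 1) dπ`, whose supremum over `g` is `klDiv μ π`. -/
noncomputable def dualFunctional (μ π : Measure X) (g : X → ℝ) : ℝ :=
  (∫ x, g x ∂μ) - ∫ x, (Real.exp (g x) - 1) ∂π

lemma mul_sub_exp_le_klFun {x : ℝ} (hx : 0 ≤ x) (y : ℝ) :
    x * y - (Real.exp y - 1) ≤ klFun x := by
  rw [klFun_apply]
  rcases hx.eq_or_lt with rfl | hx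
  · have := Real.exp_pos y
    simp only [zero_mul]; linarith
  · have h1 := Real.add_one_le_exp (y - Real.log x)
    have h2 : Real.exp y = x * Real.exp (y - Real.log x) := by
      rw [Real.exp_sub, Real.exp_log hx]; field_simp
    have := mul_le_mul_of_nonneg_left h1 hx.le
    rw [h2]; linarith

lemma integrable_of_bounded {μ : Measure X} [IsFiniteMeasure μ] {g : X → ℝ} (hg : Measurable g)
    {C : ℝ} (hC : ∀ x, |g x| ≤ C) : Integrable g μ :=
  Integrable.of_bound hg.aestronglyMeasurable C (ae_of_all _ hC)

lemma integrable_exp_sub_one_of_bounded {μ : Measure X} [IsFiniteMeasure μ] {g : X → ℝ}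
    (hg : Measurable g) {C : ℝ} (hC : ∀ x, |g x| ≤ C) :
    Integrable (fun x => Real.exp (g x) - 1) μ := by
  refine Integrable.sub (integrable_of_bounded (C := Real.exp C) hg.exp fun x => ?_)
    (integrable_const _)
  rw [abs_of_pos (Real.exp_pos _)]
  exact Real.exp_le_exp.2 ((le_abs_self _).trans (hC x))

lemma integral_rnDeriv_mul {μ π : Measure X} [IsFiniteMeasure μ] [IsFiniteMeasure π]
    (h : μ ≪ π) (g : X → ℝ) :
    ∫ x, g x ∂μ = ∫ x, (μ.rnDeriv π x).toReal * g x ∂π := by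
  rw [← integral_rnDeriv_smul h]; rfl

lemma integrable_rnDeriv_mul {μ π : Measure X} [IsFiniteMeasure μ] [IsFiniteMeasure π]
    {g : X → ℝ} (hg : Measurable g) {C : ℝ} (hC : ∀ x, |g x| ≤ C) :
    Integrable (fun x => (μ.rnDeriv π x).toReal * g x) π :=
  Measure.integrable_toReal_rnDeriv.mul_bdd hg.aestronglyMeasurable (ae_of_all _ hC)

lemma dualFunctional_le_klDiv {μ π : Measure X} [IsFiniteMeasure μ] [IsFiniteMeasure π]
    {g : X → ℝ} (hg : Measurable g) {C : ℝ} (hC : ∀ x, |g x| ≤ C) :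
    ENNReal.ofReal (dualFunctional μ π g) ≤ klDiv μ π := by
  by_cases htop : klDiv μ π = ∞
  · simp [htop]
  obtain ⟨hac, hint⟩ := klDiv_ne_top_iff.1 htop
  rw [klDiv_eq_integral_klFun, if_pos ⟨hac, hint⟩]
  apply ENNReal.ofReal_le_ofReal
  have h1 := integrable_rnDeriv_mul (μ := μ) (π := π) hg hC
  have h2 := integrable_exp_sub_one_of_bounded (μ := π) hg hC
  rw [dualFunctional, integral_rnDeriv_mul hac, ← integral_sub h1 h2]
  exact integral_mono (h1.sub h2) ((integrable_klFun_rnDeriv_iff hac).2 hint)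
    fun x => mul_sub_exp_le_klFun ENNReal.toReal_nonneg _

/-- The truncation of `x` to `[1/(n+1), n+1]`. -/
noncomputable def clip (n : ℕ) (x : ℝ) : ℝ := max ((n : ℝ) + 1)⁻¹ (min ((n : ℝ) + 1) x)

lemma measurable_clip (n : ℕ) : Measurable (clip n) := by unfold clip; fun_prop

lemma inv_succ_le_one (n : ℕ) : ((n : ℝ) + 1)⁻¹ ≤ 1 :=
  inv_le_one_of_one_le₀ (by linarith [n.cast_nonneg (α := ℝ)])

lemma clip_pos (n : ℕ) (x : ℝ) : 0 < clip n x :=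
  lt_of_lt_of_le (by positivity) (le_max_left _ _)

lemma abs_log_clip_le (n : ℕ) (x : ℝ) : |Real.log (clip n x)| ≤ Real.log ((n : ℝ) + 1) := by
  have hn : (1 : ℝ) ≤ n + 1 := by linarith [n.cast_nonneg (α := ℝ)]
  rw [abs_le]
  constructor
  · rw [← Real.log_inv]
    exact Real.log_le_log (by positivity) (le_max_left _ _)
  · exact Real.log_le_log (clip_pos n x)
      (max_le ((inv_succ_le_one n).trans hn) (min_le_left _ _))

lemma mul_log_clip_nonneg (n : ℕ) (x : ℝ) :
    0 ≤ x * Real.log (clip n x) - (clip n x - 1) := by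
  have hk := klFun_nonneg (clip_pos n x).le
  rw [klFun_apply] at hk
  have hn : (1 : ℝ) ≤ n + 1 := by linarith [n.cast_nonneg (α := ℝ)]
  have key : clip n x * Real.log (clip n x) ≤ x * Real.log (clip n x) := by
    rcases le_total 1 x with hx | hx
    · refine mul_le_mul_of_nonneg_right ?_ (Real.log_nonneg ?_)
      · exact max_le ((inv_succ_le_one n).trans hx) (min_le_right _ _)
      · exact le_max_of_le_right (le_min hn hx)
    · refine mul_le_mul_of_nonpos_right ?_ (Real.log_nonpos (clip_pos n x).le ?_)
      · exact le_max_of_le_right (le_min (hx.trans hn) le_rfl)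
      · exact max_le (inv_succ_le_one n) ((min_le_right _ _).trans hx)
  linarith

lemma tendsto_mul_log_clip {x : ℝ} (hx : 0 ≤ x) :
    Tendsto (fun n => x * Real.log (clip n x) - (clip n x - 1)) atTop (𝓝 (klFun x)) := by
  have hinv : Tendsto (fun n : ℕ => ((n : ℝ) + 1)⁻¹) atTop (𝓝 0) := by
    simpa using tendsto_one_div_add_atTop_nhds_zero_nat (𝕜 := ℝ)
  have hcast : Tendsto (fun n : ℕ => (n : ℝ) + 1) atTop atTop :=
    tendsto_natCast_atTop_atTop.atTop_add tendsto_const_nhds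
  rcases hx.eq_or_lt with rfl | hx
  · have h : ∀ n, clip n 0 = ((n : ℝ) + 1)⁻¹ := fun n => by
      rw [clip, min_eq_right (by positivity), max_eq_left (by positivity)]
    simp only [h, zero_mul, klFun_zero]
    simpa using (hinv.sub_const 1).const_sub 0
  · refine tendsto_const_nhds.congr' ?_
    filter_upwards [hinv.eventually (gt_mem_nhds hx), hcast.eventually_ge_atTop x] with n h1 h2
    have : clip n x = x := by rw [clip, min_eq_right h2, max_eq_right h1.le]
    rw [this, klFun_apply]; ring

lemma exists_measurable_lt_dualFunctional {μ π : Measure X} [IsFiniteMeasure μ]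
    [IsFiniteMeasure π] {a : ℝ≥0∞} (ha : a < klDiv μ π) :
    ∃ (g : X → ℝ) (C : ℝ), Measurable g ∧ (∀ x, |g x| ≤ C) ∧
      a < ENNReal.ofReal (dualFunctional μ π g) := by
  by_cases hac : μ ≪ π
  · rw [klDiv_eq_lintegral_klFun_of_ac hac] at ha
    set f : X → ℝ := fun x => (μ.rnDeriv π x).toReal with hf
    have hfm : Measurable f := (Measure.measurable_rnDeriv μ π).ennreal_toReal
    set φ : ℕ → X → ℝ := fun n x => f x * Real.log (clip n (f x)) - (clip n (f x) - 1) with hφ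
    have hcm : ∀ n, Measurable fun x => clip n (f x) := fun n => (measurable_clip n).comp hfm
    have hφm : ∀ n, Measurable (φ n) := fun n =>
      (hfm.mul (hcm n).log).sub ((hcm n).sub_const 1)
    have hlim : ∀ x, liminf (fun n => ENNReal.ofReal (φ n x)) atTop
        = ENNReal.ofReal (klFun (f x)) := fun x =>
      ((ENNReal.continuous_ofReal.tendsto _).comp
        (tendsto_mul_log_clip ENNReal.toReal_nonneg)).liminf_eq
    have hfatou := lintegral_liminf_le (μ := π) (u := atTop) (f := fun n x => ENNReal.ofReal (φ n x))
      fun n => (hφm n).ennreal_ofReal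
    simp only [hlim] at hfatou
    obtain ⟨n, hn⟩ := (eventually_lt_of_lt_liminf (ha.trans_le hfatou)).exists
    have hgm : Measurable fun x => Real.log (clip n (f x)) := (hcm n).log
    have hgb : ∀ x, |Real.log (clip n (f x))| ≤ Real.log ((n : ℝ) + 1) :=
      fun x => abs_log_clip_le n _
    refine ⟨fun x => Real.log (clip n (f x)), _, hgm, hgb, ?_⟩
    have h1 := integrable_rnDeriv_mul (μ := μ) (π := π) hgm hgb
    have h2 := integrable_exp_sub_one_of_bounded (μ := π) hgm hgb
    have h3 : Integrable (φ n) π := by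
      have := h1.sub h2
      simp only [Real.exp_log (clip_pos _ _)] at this
      exact this
    rw [dualFunctional, integral_rnDeriv_mul hac, ← integral_sub h1 h2]
    simp only [Real.exp_log (clip_pos _ _)]
    change a < ENNReal.ofReal (∫ x, φ n x ∂π)
    rwa [ofReal_integral_eq_lintegral_ofReal h3
      (ae_of_all _ fun x => mul_log_clip_nonneg n (f x))]
  · obtain ⟨s, hs, hπs, hμs⟩ : ∃ s, MeasurableSet s ∧ π s = 0 ∧ μ s ≠ 0 := by
      by_contra! h
      exact hac (Measure.AbsolutelyContinuous.mk fun s hs h0 => h s hs h0)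
    have hpos : 0 < μ.real s := ENNReal.toReal_pos hμs (measure_ne_top _ _)
    obtain ⟨n, hn⟩ := exists_nat_gt (a.toReal / μ.real s)
    refine ⟨s.indicator fun _ => (n : ℝ), n, measurable_const.indicator hs, fun x => ?_, ?_⟩
    · by_cases hx : x ∈ s <;> simp [hx]
    · have h0 : ∫ x, (Real.exp (s.indicator (fun _ => (n : ℝ)) x) - 1) ∂π = 0 := by
        refine integral_eq_zero_of_ae ?_
        filter_upwards [measure_eq_zero_iff_ae_notMem.1 hπs] with x hx
        simp [hx]
      rw [dualFunctional, h0, integral_indicator_const _ hs, sub_zero, smul_eq_mul,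
        ENNReal.lt_ofReal_iff_toReal_lt ha.ne_top, mul_comm]
      exact (div_lt_iff₀ hpos).1 hn

lemma abs_exp_sub_exp_le {x y M : ℝ} (hx : x ≤ M) (hy : y ≤ M) :
    |Real.exp x - Real.exp y| ≤ Real.exp M * |x - y| := by
  wlog h : y ≤ x generalizing x y
  · rw [abs_sub_comm, abs_sub_comm x]; exact this hy hx (le_of_not_ge h)
  rw [abs_of_nonneg (sub_nonneg.2 (Real.exp_le_exp.2 h)), abs_of_nonneg (sub_nonneg.2 h)]
  have h1 := Real.add_one_le_exp (y - x)
  have h2 : Real.exp y = Real.exp x * Real.exp (y - x) := by rw [← Real.exp_add]; ring_nf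
  have h3 := mul_le_mul_of_nonneg_left h1 (Real.exp_pos x).le
  have h4 := mul_le_mul_of_nonneg_right (Real.exp_le_exp.2 hx) (sub_nonneg.2 h)
  rw [h2]; linarith

lemma abs_dualFunctional_sub_le {μ π : Measure X} [IsFiniteMeasure μ] [IsFiniteMeasure π]
    {g h : X → ℝ} (hg : Measurable g) (hh : Measurable h) {C : ℝ} (hgC : ∀ x, |g x| ≤ C)
    (hhC : ∀ x, |h x| ≤ C) :
    |dualFunctional μ π g - dualFunctional μ π h|
      ≤ (∫ x, |g x - h x| ∂μ) + Real.exp C * ∫ x, |g x - h x| ∂π := by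
  have e : dualFunctional μ π g - dualFunctional μ π h = (∫ x, (g x - h x) ∂μ)
      - ∫ x, ((Real.exp (g x) - 1) - (Real.exp (h x) - 1)) ∂π := by
    rw [integral_sub (integrable_of_bounded hg hgC) (integrable_of_bounded hh hhC),
      integral_sub (integrable_exp_sub_one_of_bounded hg hgC)
        (integrable_exp_sub_one_of_bounded hh hhC), dualFunctional, dualFunctional]
    ring
  rw [e]
  refine (abs_sub _ _).trans (add_le_add abs_integral_le_integral_abs ?_)
  rw [← integral_const_mul]
  refine abs_integral_le_integral_abs.trans (integral_mono_of_nonneg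
    (ae_of_all _ fun _ => abs_nonneg _) ?_ (ae_of_all _ fun x => ?_))
  · exact (((integrable_of_bounded hg hgC).sub (integrable_of_bounded hh hhC)).abs).const_mul _
  · simp only [sub_sub_sub_cancel_right]
    exact abs_exp_sub_exp_le ((le_abs_self _).trans (hgC x)) ((le_abs_self _).trans (hhC x))

lemma exists_continuous_lt_dualFunctional [TopologicalSpace X] [NormalSpace X] [BorelSpace X]
    {μ π : Measure X} [IsFiniteMeasure μ] [IsFiniteMeasure π] [(μ + π).WeaklyRegular]
    {a : ℝ≥0∞} (ha : a < klDiv μ π) :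
    ∃ (g : X → ℝ) (C : ℝ), Continuous g ∧ (∀ x, |g x| ≤ C) ∧
      a < ENNReal.ofReal (dualFunctional μ π g) := by
  obtain ⟨g, C, hg, hgC, hag⟩ := exists_measurable_lt_dualFunctional ha
  rw [ENNReal.lt_ofReal_iff_toReal_lt ha.ne_top] at hag
  set D := |C| with hD
  have hgD : ∀ x, |g x| ≤ D := fun x => (hgC x).trans (le_abs_self C)
  have hD0 : 0 ≤ D := abs_nonneg C
  set ε := (dualFunctional μ π g - a.toReal) / (2 * (1 + Real.exp D)) with hε
  have hε0 : 0 < ε := by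
    have := sub_pos.2 hag
    positivity
  obtain ⟨k, hk, hkint⟩ := (integrable_of_bounded (μ := μ + π) hg
    hgD).exists_boundedContinuous_integral_sub_le hε0
  set h : X → ℝ := fun x => max (-D) (min D (k x)) with hh
  have hhc : Continuous h := by fun_prop
  have hhD : ∀ x, |h x| ≤ D := fun x => abs_le.2
    ⟨le_max_left _ _, max_le (by linarith) (min_le_left _ _)⟩
  have hle : ∀ x, |g x - h x| ≤ ‖g x - k x‖ := fun x => by
    have e : g x = max (-D) (min D (g x)) := by
      rw [min_eq_right (abs_le.1 (hgD x)).2, max_eq_right (abs_le.1 (hgD x)).1]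
    rw [Real.norm_eq_abs]
    conv_lhs => rw [e]
    have h1 := abs_max_sub_max_le_max (-D) (min D (g x)) (-D) (min D (k x))
    have h2 := abs_min_sub_min_le_max D (g x) D (k x)
    simp only [sub_self, abs_zero, abs_nonneg, sup_of_le_right] at h1 h2
    exact h1.trans h2
  have hint : Integrable (fun x => ‖g x - k x‖) (μ + π) :=
    ((integrable_of_bounded hg hgD).sub hkint).norm
  have hsum := integral_add_measure (f := fun x => ‖g x - k x‖) hint.left_of_add_measure
    hint.right_of_add_measure
  rw [hsum] at hk
  have n1 : 0 ≤ ∫ x, ‖g x - k x‖ ∂μ := integral_nonneg fun _ => norm_nonneg _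
  have n2 : 0 ≤ ∫ x, ‖g x - k x‖ ∂π := integral_nonneg fun _ => norm_nonneg _
  have m1 : ∫ x, |g x - h x| ∂μ ≤ ∫ x, ‖g x - k x‖ ∂μ := integral_mono_of_nonneg
    (ae_of_all _ fun _ => abs_nonneg _) hint.left_of_add_measure (ae_of_all _ hle)
  have m2 : ∫ x, |g x - h x| ∂π ≤ ∫ x, ‖g x - k x‖ ∂π := integral_mono_of_nonneg
    (ae_of_all _ fun _ => abs_nonneg _) hint.right_of_add_measure (ae_of_all _ hle)
  refine ⟨h, D, hhc, hhD, ?_⟩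
  rw [ENNReal.lt_ofReal_iff_toReal_lt ha.ne_top]
  have hd := abs_dualFunctional_sub_le (μ := μ) (π := π) hg hhc.measurable hgD hhD
  have hεe : ε + Real.exp D * ε = (dualFunctional μ π g - a.toReal) / 2 := by
    rw [hε]; field_simp
  have m3 : Real.exp D * ∫ x, |g x - h x| ∂π ≤ Real.exp D * ε :=
    mul_le_mul_of_nonneg_left (by linarith) (Real.exp_pos D).le
  have := (le_abs_self _).trans hd
  linarith [sub_pos.2 hag]

/-- Relative entropy is lower semicontinuous in its first argument for the weak topology. -/
lemma lowerSemicontinuous_klDiv [TopologicalSpace X] [NormalSpace X] [BorelSpace X]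
    (π : Measure X) [IsFiniteMeasure π]
    [∀ μ : ProbabilityMeasure X, ((μ : Measure X) + π).WeaklyRegular] :
    LowerSemicontinuous fun μ : ProbabilityMeasure X => klDiv (μ : Measure X) π := by
  intro μ a ha
  obtain ⟨g, C, hg, hgC, hag⟩ := exists_continuous_lt_dualFunctional ha
  let G : BoundedContinuousFunction X ℝ := .ofNormedAddCommGroup g hg C hgC
  have hc : Tendsto (fun σ : ProbabilityMeasure X => ENNReal.ofReal (dualFunctional σ π g)) (𝓝 μ)
      (𝓝 (ENNReal.ofReal (dualFunctional μ π g))) :=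
    (ENNReal.continuous_ofReal.tendsto _).comp
      (((ProbabilityMeasure.tendsto_iff_forall_integral_tendsto.1 tendsto_id) G).sub_const _)
  filter_upwards [hc.eventually (lt_mem_nhds hag)] with σ hσ
  exact hσ.trans_le (dualFunctional_le_klDiv hg.measurable hgC)

end Duality

end HLEntropy

namespace HLEntropy

section Blocks

open InformationTheory Topology

variable {m : ℕ}

/-- The index of the block of `[0,1]` that contains `t`. -/
noncomputable def blockIndex (m : ℕ) [NeZero m] (t : unitInterval) : Fin m :=
  ⟨min ⌊(t : ℝ) * m⌋₊ (m - 1), by have := NeZero.pos m; omega⟩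

lemma mem_timeBlock_iff [NeZero m] {t : unitInterval} {i : Fin m} :
    t ∈ timeBlock m i ↔ blockIndex m t = i := by
  have hm : (0 : ℝ) < m := Nat.cast_pos.2 (NeZero.pos m)
  have h0 : 0 ≤ (t : ℝ) * m := mul_nonneg t.2.1 hm.le
  have h1 : ((i : ℕ) : ℝ) / m ≤ t ↔ (i : ℕ) ≤ ⌊(t : ℝ) * m⌋₊ := by
    rw [div_le_iff₀ hm, Nat.le_floor_iff h0]
  have h2 : (t : ℝ) < (((i : ℕ) : ℝ) + 1) / m ↔ ⌊(t : ℝ) * m⌋₊ < (i : ℕ) + 1 := by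
    rw [lt_div_iff₀ hm, Nat.floor_lt h0]; push_cast; rfl
  rw [timeBlock, Set.mem_ofPred_eq, h1, h2, Fin.ext_iff, blockIndex]
  have := i.2
  simp only
  omega

lemma ordConnected_timeBlock (i : Fin m) : (timeBlock m i).OrdConnected := by
  refine ⟨fun x hx y hy z hz => ⟨hx.1.trans hz.1, ?_⟩⟩
  rcases hy.2 with h | h
  · exact Or.inl (lt_of_le_of_lt hz.2 h)
  · exact Or.inr h

lemma measurableSet_timeBlock (i : Fin m) : MeasurableSet (timeBlock m i) :=
  (ordConnected_timeBlock i).measurableSet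

/-- The left endpoint of a block. -/
noncomputable def blockStart (i : Fin m) : unitInterval :=
  ⟨((i : ℕ) : ℝ) / m, by positivity,
    div_le_one_of_le₀ (Nat.cast_le.2 i.2.le) (Nat.cast_nonneg m)⟩

/-- The right endpoint of a block. -/
noncomputable def blockEnd (i : Fin m) : unitInterval :=
  ⟨(((i : ℕ) : ℝ) + 1) / m, by positivity,
    div_le_one_of_le₀ (by exact_mod_cast i.2) (Nat.cast_nonneg m)⟩

lemma blockEnd_sub_blockStart (i : Fin m) :
    (blockEnd i : ℝ) - blockStart i = (m : ℝ)⁻¹ := by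
  simp only [blockEnd, blockStart]; ring

lemma Ico_subset_timeBlock (i : Fin m) : Set.Ico (blockStart i) (blockEnd i) ⊆ timeBlock m i :=
  fun _ ht => ⟨ht.1, Or.inl ht.2⟩

lemma timeBlock_subset_Icc (i : Fin m) : timeBlock m i ⊆ Set.Icc (blockStart i) (blockEnd i) := by
  rintro t ⟨h1, h2⟩
  refine ⟨h1, ?_⟩
  rcases h2 with h2 | h2
  · exact le_of_lt h2
  · have h3 : (((i : ℕ) : ℝ) + 1) = m := by exact_mod_cast h2
    have hm : (m : ℝ) ≠ 0 := by rw [← h3]; positivity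
    change (t : ℝ) ≤ (((i : ℕ) : ℝ) + 1) / m
    rw [h3, div_self hm]
    exact t.2.2

lemma volume_timeBlock (i : Fin m) : volume (timeBlock m i) = (m : ℝ≥0∞)⁻¹ := by
  have hm : (0 : ℝ) < m := Nat.cast_pos.2 i.pos
  have hmi : ENNReal.ofReal ((blockEnd i : ℝ) - blockStart i) = (m : ℝ≥0∞)⁻¹ := by
    rw [blockEnd_sub_blockStart, ENNReal.ofReal_inv_of_pos hm, ENNReal.ofReal_natCast]
  apply le_antisymm
  · refine (measure_mono (timeBlock_subset_Icc i)).trans ?_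
    rw [unitInterval.volume_Icc, hmi]
  · refine le_trans ?_ (measure_mono (Ico_subset_timeBlock i))
    rw [unitInterval.volume_Ico, hmi]

lemma measurable_blockIndex [NeZero m] : Measurable (blockIndex m) :=
  measurable_to_countable' fun i => by
    have : blockIndex m ⁻¹' {i} = timeBlock m i := by
      ext t; simp [mem_timeBlock_iff]
    rw [this]; exact measurableSet_timeBlock i

lemma sum_restrict_eq_of_partition {Y ι : Type*} [MeasurableSpace Y] [Fintype ι] (ρ : Measure Y)
    {A : ι → Set Y} (hd : Pairwise fun i j => Disjoint (A i) (A j))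
    (hA : ∀ i, MeasurableSet (A i)) (hc : ⋃ i, A i = Set.univ) :
    ∑ i, ρ.restrict (A i) = ρ := by
  rw [← Measure.sum_fintype, ← Measure.restrict_iUnion hd hA, hc, Measure.restrict_univ]

lemma pairwise_disjoint_timeBlock [NeZero m] :
    Pairwise fun i j : Fin m => Disjoint (timeBlock m i) (timeBlock m j) := fun _ _ hij =>
  Set.disjoint_left.2 fun _ hi hj =>
    hij ((mem_timeBlock_iff.1 hi).symm.trans (mem_timeBlock_iff.1 hj))

lemma iUnion_timeBlock [NeZero m] : ⋃ i : Fin m, timeBlock m i = Set.univ :=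
  Set.eq_univ_of_forall fun t => Set.mem_iUnion.2 ⟨blockIndex m t, mem_timeBlock_iff.2 rfl⟩

lemma sum_restrict_timeBlock [NeZero m] :
    ∑ i : Fin m, (volume : Measure unitInterval).restrict (timeBlock m i) = volume :=
  sum_restrict_eq_of_partition _ pairwise_disjoint_timeBlock measurableSet_timeBlock
    iUnion_timeBlock

lemma sum_restrict_univ_prod_timeBlock [NeZero m] (ρ : Measure Cyl) :
    ∑ i : Fin m, ρ.restrict (Set.univ ×ˢ timeBlock m i) = ρ :=
  sum_restrict_eq_of_partition _
    (fun _ _ hij => Set.disjoint_prod.2 (Or.inr (pairwise_disjoint_timeBlock hij)))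
    (fun i => MeasurableSet.univ.prod (measurableSet_timeBlock i))
    (by rw [← Set.prod_iUnion, iUnion_timeBlock, Set.univ_prod_univ])

lemma stepMeasure_const [NeZero m] (lam : ProbabilityMeasure Circ) :
    stepMeasure m (fun _ => lam) = (lam : Measure Circ).prod volume := by
  rw [← sum_restrict_univ_prod_timeBlock (m := m) ((lam : Measure Circ).prod volume), stepMeasure]
  refine Finset.sum_congr rfl fun i _ => ?_
  rw [← Measure.prod_restrict, Measure.restrict_univ]

instance (ν : Fin m → ProbabilityMeasure Circ) : IsFiniteMeasure (stepMeasure m ν) := by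
  unfold stepMeasure; infer_instance

/-- On each strip `S¹ × I_i`, the first marginal of `ρ` is `ν_i / m`. -/
def HasBlockMarginals (ρ : Measure Cyl) (ν : Fin m → ProbabilityMeasure Circ) : Prop :=
  ∀ i, (ρ.restrict (Set.univ ×ˢ timeBlock m i)).map Prod.fst = (m : ℝ≥0∞)⁻¹ • (ν i : Measure Circ)

lemma hasBlockMarginals_stepMeasure [NeZero m] (ν : Fin m → ProbabilityMeasure Circ) :
    HasBlockMarginals (stepMeasure m ν) ν := by
  intro i
  ext A hA
  have hset : Prod.fst ⁻¹' A ∩ Set.univ ×ˢ timeBlock m i = A ×ˢ timeBlock m i := by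
    ext x; simp
  rw [Measure.map_apply measurable_fst hA, Measure.restrict_apply (measurable_fst hA), hset,
    stepMeasure, Measure.finsetSum_apply, Finset.sum_eq_single i]
  · rw [Measure.prod_prod, Measure.restrict_apply_self, volume_timeBlock, mul_comm]; rfl
  · intro j _ hj
    rw [Measure.prod_prod, Measure.restrict_apply (measurableSet_timeBlock i),
      (pairwise_disjoint_timeBlock hj.symm).inter_eq, measure_empty, mul_zero]
  · simp

lemma IsDriving.exists_hasBlockMarginals {μ : ProbabilityMeasure Cyl} (hμ : IsDriving μ) (m : ℕ) :
    ∃ ν : Fin m → ProbabilityMeasure Circ, HasBlockMarginals (μ : Measure Cyl) ν := by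
  have h0 : ∀ i : Fin m, (m : ℝ≥0∞) ≠ 0 := fun i => Nat.cast_ne_zero.2 i.pos.ne'
  refine ⟨fun i => ⟨(m : ℝ≥0∞) • ((μ : Measure Cyl).restrict
    (Set.univ ×ˢ timeBlock m i)).map Prod.fst, ⟨?_⟩⟩, fun i => ?_⟩
  · rw [Measure.smul_apply, Measure.map_apply measurable_fst .univ, Set.preimage_univ,
      Measure.restrict_apply_univ, hμ _ (ordConnected_timeBlock i), volume_timeBlock, smul_eq_mul,
      ENNReal.mul_inv_cancel (h0 i) (ENNReal.natCast_ne_top m)]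
  · rw [ProbabilityMeasure.coe_mk, smul_smul,
      ENNReal.inv_mul_cancel (h0 i) (ENNReal.natCast_ne_top m), one_smul]

lemma measurable_blockwise [NeZero m] {h : Fin m → Circ → ℝ} (hm : ∀ i, Measurable (h i)) :
    Measurable fun x : Cyl => h (blockIndex m x.2) x.1 := by
  have : Measurable fun p : Circ × Fin m => h p.2 p.1 := measurable_from_prod_countable_left hm
  exact this.comp (measurable_fst.prodMk (measurable_blockIndex.comp measurable_snd))

lemma HasBlockMarginals.integral_blockwise [NeZero m] {ρ : Measure Cyl} [IsFiniteMeasure ρ]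
    {ν : Fin m → ProbabilityMeasure Circ} (hρ : HasBlockMarginals ρ ν) {h : Fin m → Circ → ℝ}
    (hm : ∀ i, Measurable (h i)) {C : ℝ} (hC : ∀ i θ, |h i θ| ≤ C) :
    ∫ x, h (blockIndex m x.2) x.1 ∂ρ = (m : ℝ)⁻¹ * ∑ i, ∫ θ, h i θ ∂(ν i : Measure Circ) := by
  conv_lhs => rw [← sum_restrict_univ_prod_timeBlock (m := m) ρ]
  rw [integral_finsetSum_measure fun i _ => integrable_of_bounded (measurable_blockwise hm)
    fun x => hC _ _, Finset.mul_sum]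
  refine Finset.sum_congr rfl fun i _ => ?_
  have h1 : ∫ x in Set.univ ×ˢ timeBlock m i, h (blockIndex m x.2) x.1 ∂ρ
      = ∫ x in Set.univ ×ˢ timeBlock m i, h i x.1 ∂ρ :=
    setIntegral_congr_fun (MeasurableSet.univ.prod (measurableSet_timeBlock i)) fun x hx => by
      simp only [mem_timeBlock_iff.1 hx.2]
  rw [h1, ← integral_map (φ := Prod.fst) (f := h i) measurable_fst.aemeasurable
    (hm i).aestronglyMeasurable, hρ i, integral_smul_measure]
  simp

lemma HasBlockMarginals.dualFunctional_blockwise [NeZero m] {ρ π : Measure Cyl}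
    [IsFiniteMeasure ρ] [IsFiniteMeasure π] {ν η : Fin m → ProbabilityMeasure Circ}
    (hρ : HasBlockMarginals ρ ν) (hπ : HasBlockMarginals π η) {g : Fin m → Circ → ℝ}
    (hm : ∀ i, Measurable (g i)) {C : ℝ} (hC : ∀ i θ, |g i θ| ≤ C) :
    dualFunctional ρ π (fun x => g (blockIndex m x.2) x.1)
      = (m : ℝ)⁻¹ * ∑ i, dualFunctional (ν i : Measure Circ) (η i) (g i) := by
  have hexp : ∀ i θ, |Real.exp (g i θ) - 1| ≤ Real.exp C + 1 := fun i θ => by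
    refine (abs_sub _ _).trans (add_le_add ?_ (by simp))
    rw [abs_of_pos (Real.exp_pos _)]
    exact Real.exp_le_exp.2 ((le_abs_self _).trans (hC i θ))
  rw [dualFunctional, hρ.integral_blockwise hm hC,
    hπ.integral_blockwise (h := fun i θ => Real.exp (g i θ) - 1)
      (fun i => (hm i).exp.sub_const 1) hexp, ← mul_sub, ← Finset.sum_sub_distrib]
  rfl

lemma exists_seq_tendsto_klDiv {X : Type*} [MeasurableSpace X] (μ π : Measure X)
    [IsFiniteMeasure μ] [IsFiniteMeasure π] :
    ∃ (g : ℕ → X → ℝ) (C : ℕ → ℝ), (∀ n, Measurable (g n)) ∧ (∀ n x, |g n x| ≤ C n) ∧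
      (∀ n, 0 ≤ dualFunctional μ π (g n)) ∧
      Tendsto (fun n => ENNReal.ofReal (dualFunctional μ π (g n))) atTop (𝓝 (klDiv μ π)) := by
  rcases eq_or_ne (klDiv μ π) 0 with h0 | h0
  · exact ⟨fun _ _ => 0, fun _ => 0, fun _ => measurable_const, fun _ _ => by simp,
      fun _ => by simp [dualFunctional], by simp [dualFunctional, h0]⟩
  · obtain ⟨u, -, hu, hlim⟩ := exists_seq_strictMono_tendsto' (pos_iff_ne_zero.2 h0)
    choose g C hg hC hlt using fun n => exists_measurable_lt_dualFunctional (hu n).2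
    refine ⟨g, C, hg, hC, fun n => ?_, ?_⟩
    · exact (ENNReal.ofReal_pos.1 ((hu n).1.trans (hlt n))).le
    · exact tendsto_of_tendsto_of_tendsto_of_le_of_le hlim tendsto_const_nhds
        (fun n => (hlt n).le) fun n => dualFunctional_le_klDiv (hg n) (hC n)

/-- Averaging over the blocks does not increase the relative entropy. -/
lemma HasBlockMarginals.sum_klDiv_le [NeZero m] {ρ π : Measure Cyl}
    [IsFiniteMeasure ρ] [IsFiniteMeasure π] {ν η : Fin m → ProbabilityMeasure Circ}
    (hρ : HasBlockMarginals ρ ν) (hπ : HasBlockMarginals π η) :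
    (m : ℝ≥0∞)⁻¹ * ∑ i, klDiv (ν i : Measure Circ) (η i) ≤ klDiv ρ π := by
  have hm : (0 : ℝ) < m := Nat.cast_pos.2 (NeZero.pos m)
  choose g C hg hC h0 hlim using fun i => exists_seq_tendsto_klDiv (ν i : Measure Circ) (η i)
  have hsum := tendsto_finsetSum Finset.univ fun i _ => hlim i
  refine le_of_tendsto' (ENNReal.Tendsto.const_mul hsum (Or.inr ?_)) fun n => ?_
  · exact ENNReal.inv_ne_top.2 (Nat.cast_ne_zero.2 (NeZero.ne m))
  have hB : ∀ i θ, |g i n θ| ≤ ∑ j, |C j n| := fun i θ =>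
    ((hC i n θ).trans (le_abs_self _)).trans
      (Finset.single_le_sum (f := fun j => |C j n|) (fun _ _ => abs_nonneg _) (Finset.mem_univ i))
  have key := hρ.dualFunctional_blockwise hπ (g := fun i => g i n) (fun i => hg i n) hB
  rw [← ENNReal.ofReal_sum_of_nonneg fun i _ => h0 i n, ← ENNReal.ofReal_natCast m,
    ← ENNReal.ofReal_inv_of_pos hm, ← ENNReal.ofReal_mul (inv_nonneg.2 hm.le), ← key]
  exact dualFunctional_le_klDiv (measurable_blockwise (h := fun i => g i n) fun i => hg i n)
    fun x => hB _ _

lemma dualFunctional_stepMeasure [NeZero m] {ν η : Fin m → ProbabilityMeasure Circ} {g : Cyl → ℝ}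
    (hg : Measurable g) {C : ℝ} (hC : ∀ x, |g x| ≤ C) :
    dualFunctional (stepMeasure m ν) (stepMeasure m η) g
      = ∑ i, ∫ t in timeBlock m i,
          dualFunctional (ν i : Measure Circ) (η i) (fun θ => g (θ, t)) := by
  have hi : ∀ ρ : Measure Cyl, IsFiniteMeasure ρ → Integrable g ρ :=
    fun ρ _ => integrable_of_bounded hg hC
  have he : ∀ ρ : Measure Cyl, IsFiniteMeasure ρ → Integrable (fun x => Real.exp (g x) - 1) ρ :=
    fun ρ _ => integrable_exp_sub_one_of_bounded hg hC
  rw [dualFunctional, stepMeasure, stepMeasure,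
    integral_finsetSum_measure fun i _ => hi _ inferInstance,
    integral_finsetSum_measure fun i _ => he _ inferInstance, ← Finset.sum_sub_distrib]
  refine Finset.sum_congr rfl fun i _ => ?_
  rw [integral_prod_symm _ (hi _ inferInstance), integral_prod_symm _ (he _ inferInstance),
    ← integral_sub (hi _ inferInstance).integral_prod_right
      (he _ inferInstance).integral_prod_right]
  rfl

/-- The relative entropy of a step measure is at most the average of those of its blocks. -/
lemma klDiv_stepMeasure_le [NeZero m] (ν η : Fin m → ProbabilityMeasure Circ) :
    klDiv (stepMeasure m ν) (stepMeasure m η)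
      ≤ (m : ℝ≥0∞)⁻¹ * ∑ i, klDiv (ν i : Measure Circ) (η i) := by
  by_contra! hlt
  have hm0 : (m : ℝ≥0∞)⁻¹ ≠ 0 := ENNReal.inv_ne_zero.2 (ENNReal.natCast_ne_top m)
  have hfin : ∀ i, klDiv (ν i : Measure Circ) (η i) ≠ ∞ := fun i hi => by
    have : ∑ i, klDiv (ν i : Measure Circ) (η i) = ∞ :=
      ENNReal.sum_eq_top.2 ⟨i, Finset.mem_univ i, hi⟩
    rw [this, ENNReal.mul_top hm0] at hlt
    exact not_top_lt hlt
  obtain ⟨g, C, hg, hC, hag⟩ := exists_measurable_lt_dualFunctional hlt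
  rw [ENNReal.lt_ofReal_iff_toReal_lt hlt.ne_top, dualFunctional_stepMeasure hg hC,
    ENNReal.toReal_mul, ENNReal.toReal_sum fun i _ => hfin i, Finset.mul_sum] at hag
  refine absurd hag (not_lt.2 (Finset.sum_le_sum fun i _ => ?_))
  have hvol : volume.real (timeBlock m i) = ((m : ℝ≥0∞)⁻¹).toReal := by
    rw [Measure.real, volume_timeBlock]
  have hbd : ∀ t, dualFunctional (ν i : Measure Circ) (η i) (fun θ => g (θ, t))
      ≤ (klDiv (ν i : Measure Circ) (η i)).toReal := fun t =>
    (ENNReal.ofReal_le_iff_le_toReal (hfin i)).1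
      (dualFunctional_le_klDiv (hg.comp measurable_prodMk_right) fun θ => hC _)
  have hint : Integrable (fun t => dualFunctional (ν i : Measure Circ) (η i) fun θ => g (θ, t))
      (volume.restrict (timeBlock m i)) :=
    Integrable.sub (Integrable.integral_prod_right
      (μ := (ν i : Measure Circ)) (integrable_of_bounded hg hC))
      (Integrable.integral_prod_right
        (μ := (η i : Measure Circ)) (integrable_exp_sub_one_of_bounded hg hC))
  refine (integral_mono hint (integrable_const _) hbd).trans_eq ?_
  rw [integral_const, smul_eq_mul, measureReal_restrict_apply_univ, hvol]

lemma klDiv_le_stepRate [NeZero m] (lam : ProbabilityMeasure Circ) (σ : ProbabilityMeasure Cyl) :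
    klDiv (σ : Measure Cyl) ((lam : Measure Circ).prod volume) ≤ stepRate lam m σ := by
  refine le_iInf₂ fun ν hν => ?_
  rw [hν, ← stepMeasure_const (m := m) lam]
  exact klDiv_stepMeasure_le ν fun _ => lam

end Blocks

end HLEntropy

namespace HLEntropy

section KantorovichRubinstein

open Topology

lemma continuous_of_abs_sub_le {f : Cyl → ℝ}
    (hf : ∀ x y, |f x - f y| ≤ dist x.1 y.1 + dist x.2 y.2) : Continuous f := by
  refine (LipschitzWith.of_dist_le_mul (K := 2) fun x y => ?_).continuous
  rw [Real.dist_eq, NNReal.coe_ofNat, two_mul]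
  exact (hf x y).trans (add_le_add (le_max_left _ _) (le_max_right _ _))

lemma abs_integral_sub_le_dKR (σ τ : ProbabilityMeasure Cyl) {f : Cyl → ℝ}
    (hf : ∀ x y, |f x - f y| ≤ dist x.1 y.1 + dist x.2 y.2) (hf1 : ∀ x, |f x| ≤ 1) :
    |(∫ x, f x ∂(σ : Measure Cyl)) - ∫ x, f x ∂(τ : Measure Cyl)| ≤ dKR σ τ := by
  refine le_csSup ⟨2, ?_⟩ ⟨f, hf, hf1, rfl⟩
  rintro r ⟨g, -, hg, rfl⟩
  have h : ∀ ρ : ProbabilityMeasure Cyl, |∫ x, g x ∂(ρ : Measure Cyl)| ≤ 1 := fun ρ => by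
    simpa using norm_integral_le_of_norm_le_const (μ := (ρ : Measure Cyl)) (f := g) (C := 1)
      (ae_of_all _ hg)
  exact (abs_sub _ _).trans (by linarith [h σ, h τ])

/-- Every weak neighbourhood contains a ball for the Kantorovich–Rubinstein distance. -/
lemma exists_dKR_ball_subset {μ : ProbabilityMeasure Cyl} {U : Set (ProbabilityMeasure Cyl)}
    (hU : U ∈ 𝓝 μ) : ∃ δ > 0, ∀ σ, dKR μ σ < δ → σ ∈ U := by
  by_contra! h
  choose σ hσ hσU using fun n : ℕ => h (1 / ((n : ℝ) + 1)) Nat.one_div_pos_of_nat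
  suffices hlim : Tendsto σ atTop (𝓝 μ) by
    obtain ⟨n, hn⟩ := (hlim.eventually hU).exists
    exact hσU n hn
  rw [tendsto_iff_forall_lipschitz_integral_tendsto]
  rintro f ⟨B, hB⟩ ⟨L, hL⟩
  let x₀ : Cyl := (0, 0)
  set c : ℝ := L + B + |f x₀| + 1 with hc
  have hB0 : 0 ≤ B := dist_nonneg.trans (hB x₀ x₀)
  have hc0 : 0 < c := by positivity
  have htest : ∀ x y, |f x / c - f y / c| ≤ dist x.1 y.1 + dist x.2 y.2 := fun x y => by
    have h1 := hL.dist_le_mul x y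
    rw [Real.dist_eq] at h1
    have h2 : dist x y ≤ dist x.1 y.1 + dist x.2 y.2 := by
      rw [Prod.dist_eq]
      exact max_le_add_of_nonneg dist_nonneg dist_nonneg
    rw [← sub_div, abs_div, abs_of_pos hc0, div_le_iff₀ hc0]
    have h3 : (L : ℝ) ≤ c := by rw [hc]; linarith [abs_nonneg (f x₀)]
    calc |f x - f y| ≤ L * dist x y := h1
      _ ≤ c * (dist x.1 y.1 + dist x.2 y.2) := by gcongr
      _ = _ := mul_comm _ _
  have hbound : ∀ x, |f x / c| ≤ 1 := fun x => by
    rw [abs_div, abs_of_pos hc0, div_le_one hc0]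
    have h1 := hB x x₀
    rw [Real.dist_eq] at h1
    have h2 := abs_sub_abs_le_abs_sub (f x) (f x₀)
    rw [hc]; linarith [L.coe_nonneg]
  have hlim : Tendsto (fun n : ℕ => c * (1 / ((n : ℝ) + 1))) atTop (𝓝 0) := by
    simpa using (tendsto_one_div_add_atTop_nhds_zero_nat (𝕜 := ℝ)).const_mul c
  refine tendsto_iff_dist_tendsto_zero.2 (squeeze_zero (fun _ => dist_nonneg) (fun n => ?_) hlim)
  have h1 := (abs_integral_sub_le_dKR μ (σ n) htest hbound).trans (hσ n).le
  rw [integral_div, integral_div, ← sub_div, abs_div, abs_of_pos hc0, div_le_iff₀ hc0] at h1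
  rw [dist_comm, Real.dist_eq]
  exact h1.trans_eq (mul_comm _ _)

lemma HasBlockMarginals.dKR_le {m : ℕ} [NeZero m] {μ σ : ProbabilityMeasure Cyl}
    {ν : Fin m → ProbabilityMeasure Circ} (hμ : HasBlockMarginals (μ : Measure Cyl) ν)
    (hσ : HasBlockMarginals (σ : Measure Cyl) ν) : dKR μ σ ≤ 2 * (m : ℝ)⁻¹ := by
  refine csSup_le ⟨_, fun _ => 0, fun x y => ?_, fun _ => by simp, rfl⟩ ?_
  · simp only [sub_self, abs_zero]; positivity
  rintro r ⟨f, hf, hf1, rfl⟩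
  have hfm := (continuous_of_abs_sub_le hf).measurable
  let h : Fin m → Circ → ℝ := fun i θ => f (θ, blockStart i)
  have hm : ∀ i, Measurable (h i) := fun i => hfm.comp measurable_prodMk_right
  have hb : ∀ i θ, |h i θ| ≤ 1 := fun i θ => hf1 _
  have hclose : ∀ x : Cyl, |f x - h (blockIndex m x.2) x.1| ≤ (m : ℝ)⁻¹ := fun x => by
    have h1 := timeBlock_subset_Icc _ (mem_timeBlock_iff.2 (rfl : blockIndex m x.2 = _))
    refine (hf _ _).trans ?_
    have h2 : (0 : ℝ) ≤ x.2 - blockStart (blockIndex m x.2) := sub_nonneg.2 h1.1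
    rw [dist_self, zero_add, Subtype.dist_eq, Real.dist_eq, abs_of_nonneg h2, ← blockEnd_sub_blockStart (blockIndex m x.2)]
    exact sub_le_sub_right (Subtype.coe_le_coe.2 h1.2) _
  have key : ∀ ρ : ProbabilityMeasure Cyl, HasBlockMarginals (ρ : Measure Cyl) ν →
      |(∫ x, f x ∂(ρ : Measure Cyl)) - (m : ℝ)⁻¹ * ∑ i, ∫ θ, h i θ ∂(ν i : Measure Circ)|
        ≤ (m : ℝ)⁻¹ := fun ρ hρ => by
    rw [← hρ.integral_blockwise hm hb, ← integral_sub (integrable_of_bounded hfm hf1)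
      (integrable_of_bounded (measurable_blockwise hm) fun x => hb _ _)]
    simpa using norm_integral_le_of_norm_le_const (μ := (ρ : Measure Cyl))
      (f := fun x => f x - h (blockIndex m x.2) x.1) (C := (m : ℝ)⁻¹) (ae_of_all _ hclose)
  have h1 := abs_le.1 (key μ hμ)
  have h2 := abs_le.1 (key σ hσ)
  rw [abs_le]
  constructor <;> linarith [h1.1, h1.2, h2.1, h2.2]

end KantorovichRubinstein

section Rate

open InformationTheory Topology

variable {m : ℕ}

lemma map_snd_stepMeasure [NeZero m] (ν : Fin m → ProbabilityMeasure Circ) :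
    (stepMeasure m ν).map Prod.snd = volume := by
  ext A hA
  rw [Measure.map_apply measurable_snd hA, ← Set.univ_prod, stepMeasure, Measure.finsetSum_apply]
  conv_rhs => rw [← sum_restrict_timeBlock (m := m), Measure.finsetSum_apply]
  exact Finset.sum_congr rfl fun i _ => by rw [Measure.prod_prod, measure_univ, one_mul]

lemma isDriving_of_map_snd_eq {μ : ProbabilityMeasure Cyl}
    (h : (μ : Measure Cyl).map Prod.snd = volume) : IsDriving μ := fun J hJ => by
  rw [← h, Measure.map_apply measurable_snd hJ.measurableSet, Set.univ_prod]

lemma isProbabilityMeasure_stepMeasure [NeZero m] (ν : Fin m → ProbabilityMeasure Circ) :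
    IsProbabilityMeasure (stepMeasure m ν) := by
  have h : (stepMeasure m ν).map Prod.snd Set.univ = 1 := by
    rw [map_snd_stepMeasure, measure_univ]
  exact ⟨by rwa [Measure.map_apply measurable_snd .univ, Set.preimage_univ] at h⟩

lemma le_approxRate {lam : ProbabilityMeasure Circ} {μ : ProbabilityMeasure Cyl} {c : ℝ≥0∞}
    (h : ∀ᶠ σ in 𝓝 μ, ∀ m : ℕ, m ≠ 0 → c ≤ stepRate lam m σ) : c ≤ approxRate lam μ := by
  obtain ⟨δ, hδ, hball⟩ := exists_dKR_ball_subset h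
  refine le_iSup₂_of_le δ hδ (le_liminf_of_le (by isBoundedDefault) ?_)
  filter_upwards [eventually_ne_atTop 0] with m hm
  exact le_iInf₂ fun σ hσ => hball σ hσ m hm

lemma lowerSemicontinuous_klDiv_reference (lam : ProbabilityMeasure Circ) :
    LowerSemicontinuous fun μ : ProbabilityMeasure Cyl =>
      klDiv (μ : Measure Cyl) ((lam : Measure Circ).prod volume) :=
  lowerSemicontinuous_klDiv _

lemma klDiv_le_approxRate (lam : ProbabilityMeasure Circ) (μ : ProbabilityMeasure Cyl) :
    klDiv (μ : Measure Cyl) ((lam : Measure Circ).prod volume) ≤ approxRate lam μ := by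
  refine le_of_forall_lt fun a ha => ?_
  obtain ⟨b, hab, hb⟩ := exists_between ha
  refine hab.trans_le (le_approxRate ?_)
  filter_upwards [lowerSemicontinuous_klDiv_reference lam μ b hb] with σ hσ m hm
  have : NeZero m := ⟨hm⟩
  exact hσ.le.trans (klDiv_le_stepRate lam σ)

lemma IsDriving.approxRate_le {μ : ProbabilityMeasure Cyl} (hμ : IsDriving μ)
    (lam : ProbabilityMeasure Circ) :
    approxRate lam μ ≤ klDiv (μ : Measure Cyl) ((lam : Measure Circ).prod volume) := by
  refine iSup₂_le fun δ hδ => ?_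
  refine (liminf_le_liminf (v := fun _ : ℕ =>
    klDiv (μ : Measure Cyl) ((lam : Measure Circ).prod volume)) ?_).trans_eq (liminf_const _)
  have hlim : Tendsto (fun m : ℕ => 2 * (m : ℝ)⁻¹) atTop (𝓝 0) := by
    simpa using (tendsto_inv_atTop_nhds_zero_nat (𝕜 := ℝ)).const_mul 2
  filter_upwards [eventually_ne_atTop 0, hlim.eventually (gt_mem_nhds hδ)] with m hm hmδ
  have : NeZero m := ⟨hm⟩
  obtain ⟨ν, hν⟩ := hμ.exists_hasBlockMarginals m
  let σ : ProbabilityMeasure Cyl := ⟨stepMeasure m ν, isProbabilityMeasure_stepMeasure ν⟩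
  have hσ : HasBlockMarginals (σ : Measure Cyl) ν := hasBlockMarginals_stepMeasure ν
  have hrate : stepRate lam m σ
      ≤ (m : ℝ≥0∞)⁻¹ * ∑ i, klDiv (ν i : Measure Circ) (lam : Measure Circ) :=
    iInf₂_le (f := fun (ν : Fin m → ProbabilityMeasure Circ)
      (_ : (σ : Measure Cyl) = stepMeasure m ν) =>
        (m : ℝ≥0∞)⁻¹ * ∑ i, klDiv (ν i : Measure Circ) (lam : Measure Circ)) ν rfl
  refine (iInf₂_le σ ((hν.dKR_le hσ).trans_lt hmδ)).trans (hrate.trans ?_)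
  have hπ := hasBlockMarginals_stepMeasure (m := m) fun _ => lam
  rw [stepMeasure_const] at hπ
  exact hν.sum_klDiv_le hπ

lemma eventually_stepRate_eq_top {μ : ProbabilityMeasure Cyl} (hμ : ¬ IsDriving μ)
    (lam : ProbabilityMeasure Circ) :
    ∀ᶠ σ in 𝓝 μ, ∀ m : ℕ, m ≠ 0 → ∞ ≤ stepRate lam m σ := by
  let π : ProbabilityMeasure unitInterval := ⟨volume, inferInstance⟩
  have hcont : Continuous fun σ : ProbabilityMeasure Cyl =>
      σ.map (f := Prod.snd) measurable_snd.aemeasurable :=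
    ProbabilityMeasure.continuous_map continuous_snd
  have hne : μ.map (f := Prod.snd) measurable_snd.aemeasurable ≠ π := fun h =>
    hμ (isDriving_of_map_snd_eq (congrArg Subtype.val h))
  filter_upwards [hcont.continuousAt.eventually_ne hne] with σ hσ m hm
  have : NeZero m := ⟨hm⟩
  refine le_iInf₂ fun ν hν => absurd (Subtype.ext ?_) hσ
  change (σ : Measure Cyl).map Prod.snd = volume
  rw [hν, map_snd_stepMeasure]

lemma approxRate_eq_top {μ : ProbabilityMeasure Cyl} (hμ : ¬ IsDriving μ)
    (lam : ProbabilityMeasure Circ) : approxRate lam μ = ∞ :=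
  top_le_iff.1 (le_approxRate (eventually_stepRate_eq_top hμ lam))

lemma lowerSemicontinuous_approxRate (lam : ProbabilityMeasure Circ) :
    LowerSemicontinuous (approxRate lam) := by
  intro μ a ha
  by_cases hμ : IsDriving μ
  · filter_upwards [lowerSemicontinuous_klDiv_reference lam μ a
      (ha.trans_le (hμ.approxRate_le lam))] with σ hσ
    exact hσ.trans_le (klDiv_le_approxRate lam σ)
  · have hlt : a < ∞ := ha.trans_le le_top
    filter_upwards [(eventually_stepRate_eq_top hμ lam).eventually_nhds] with σ hσ
    exact hlt.trans_le (le_approxRate hσ)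

end Rate

end HLEntropy

theorem approx_rate_eq_relative_entropy (lam : ProbabilityMeasure HLEntropy.Circ) :
    (∀ μ : ProbabilityMeasure HLEntropy.Cyl, HLEntropy.IsDriving μ →
      HLEntropy.approxRate lam μ =
        InformationTheory.klDiv (μ : Measure HLEntropy.Cyl)
          ((lam : Measure HLEntropy.Circ).prod (volume : Measure unitInterval))) ∧
    (∀ μ : ProbabilityMeasure HLEntropy.Cyl, ¬ HLEntropy.IsDriving μ →
      HLEntropy.approxRate lam μ = ∞) ∧
    HLEntropy.IsGoodRateFunction (HLEntropy.approxRate lam) := by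
  have : Fact (0 < 2 * Real.pi) := ⟨Real.two_pi_pos⟩
  exact ⟨fun μ hμ => le_antisymm (hμ.approxRate_le lam) (HLEntropy.klDiv_le_approxRate lam μ),
    fun _ hμ => HLEntropy.approxRate_eq_top hμ lam,
    HLEntropy.lowerSemicontinuous_approxRate lam,
    fun a => ((HLEntropy.lowerSemicontinuous_approxRate lam).isClosed_preimage a).isCompact⟩
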